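/- Let r > 0, let W be a standard Brownian motion, and let X(t) = e^{−rt} W( (e^{2rt} − 1)/(2r) ) be the Ornstein–Uhlenbeck process with mean-reversion rate r started at 0. Then T^{−1} ∫_0^T X(s)² ds → 1/(2r) almost surely as T → ∞. -/

import Mathlib

open MeasureTheory ProbabilityTheory Filter

/-- `W` is a standard Brownian motion under `P`: it is measurable in `ω` for each time,
has continuous paths on `[0,∞)`, starts at `0`, and every finite linear combination
`∑ i, c i * W (t i)` with times `t i ≥ 0` is a centered Gaussian with variance
`∑ i, ∑ j, c i * c j * min (t i) (t j)` (i.e. `W` is a centered Gaussian process with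
covariance `Cov(W s, W t) = min s t`). -/
def IsStdBM {Ω : Type*} [MeasurableSpace Ω] (P : Measure Ω) (W : ℝ → Ω → ℝ) : Prop :=
  (∀ t : ℝ, Measurable (W t)) ∧
  (∀ ω, ContinuousOn (fun t => W t ω) (Set.Ici 0)) ∧
  (∀ ω, W 0 ω = 0) ∧
  ∀ (n : ℕ) (t : Fin n → ℝ) (c : Fin n → ℝ), (∀ i, 0 ≤ t i) →
    P.map (fun ω => ∑ i, c i * W (t i) ω) =
      gaussianReal 0 (∑ i, ∑ j, c i * c j * min (t i) (t j)).toNNReal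

lemma integral_pow_four_gaussianReal_zero (v : NNReal) :
    ∫ x, x ^ 4 ∂(gaussianReal 0 v) = 3 * (v : ℝ) ^ 2 := by
  have h := iteratedDeriv_mgf_zero (X := id) (μ := gaussianReal 0 v)
    (by simp [integrableExpSet_id_gaussianReal]) 4
  rw [mgf_id_gaussianReal] at h
  set E : ℝ → ℝ := fun t => Real.exp (0 * t + v * t ^ 2 / 2) with hE
  have hderiv (a b c d : ℝ) : deriv (fun t => (a + b * t + c * t ^ 2 + d * t ^ 3) * E t) =
      fun t => (b + 2 * c * t + 3 * d * t ^ 2 +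
        (a + b * t + c * t ^ 2 + d * t ^ 3) * (v * t)) * E t := by
    funext t
    have hexp : HasDerivAt (fun t : ℝ => 0 * t + (v : ℝ) * t ^ 2 / 2) (v * t) t := by
      have := (((hasDerivAt_id t).pow 2).const_mul (v : ℝ)).div_const 2
      simpa [mul_comm, mul_left_comm, mul_div_assoc] using this
    have hpoly : HasDerivAt (fun t => a + b * t + c * t ^ 2 + d * t ^ 3)
        (b + 2 * c * t + 3 * d * t ^ 2) t := by
      have := (((hasDerivAt_const t a).add ((hasDerivAt_id t).const_mul b)).add
        (((hasDerivAt_id t).pow 2).const_mul c)).add (((hasDerivAt_id t).pow 3).const_mul d)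
      convert! this using 1
      simp
      ring
    refine (HasDerivAt.deriv (hpoly.mul hexp.exp)).trans ?_
    simp only [hE]
    ring
  have d1 : deriv E = fun t => (v * t) * E t := by
    simpa using hderiv 1 0 0 0
  have d2 : deriv (fun t => (v * t) * E t) = fun t => (v + v ^ 2 * t ^ 2) * E t := by
    have := hderiv 0 v 0 0
    ring_nf at this ⊢
    exact this
  have d3 : deriv (fun t => (v + v ^ 2 * t ^ 2) * E t) =
      fun t => (3 * v ^ 2 * t + v ^ 3 * t ^ 3) * E t := by
    have := hderiv v 0 (v ^ 2) 0
    ring_nf at this ⊢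
    exact this
  have d4 : deriv (fun t => (3 * v ^ 2 * t + v ^ 3 * t ^ 3) * E t) 0 = 3 * (v : ℝ) ^ 2 := by
    have := congrFun (hderiv 0 (3 * v ^ 2) 0 (v ^ 3)) 0
    simpa [hE] using this
  rw [iteratedDeriv_succ, iteratedDeriv_succ, iteratedDeriv_succ, iteratedDeriv_succ,
    iteratedDeriv_zero, d1, d2, d3, d4] at h
  simpa using h.symm

lemma integral_sq_gaussianReal_zero (v : NNReal) : ∫ x, x ^ 2 ∂(gaussianReal 0 v) = v := by
  have h := variance_of_integral_eq_zero (X := fun x : ℝ => x) (μ := gaussianReal 0 v)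
    (by fun_prop) (by simp)
  rw [variance_fun_id_gaussianReal] at h
  exact h.symm

section GaussianPair

variable {Ω : Type*} [MeasurableSpace Ω] {P : Measure Ω} {Z : Ω → ℝ} {v : ℝ}

lemma memLp_four_of_map_eq_gaussianReal {v : NNReal} (hZ : Measurable Z)
    (h : P.map Z = gaussianReal 0 v) : MemLp Z 4 P := by
  have := memLp_id_gaussianReal' (μ := 0) (v := v) 4 (by simp)
  rw [← h, memLp_map_measure_iff (by fun_prop) (by fun_prop)] at this
  exact this

lemma integral_pow_four_of_map_eq_gaussianReal (hv : 0 ≤ v) (hZ : Measurable Z)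
    (h : P.map Z = gaussianReal 0 v.toNNReal) : ∫ ω, Z ω ^ 4 ∂P = 3 * v ^ 2 := by
  have := integral_pow_four_gaussianReal_zero v.toNNReal
  rw [← h, integral_map (by fun_prop) (by fun_prop), Real.coe_toNNReal _ hv] at this
  exact this

lemma integral_sq_of_map_eq_gaussianReal (hv : 0 ≤ v) (hZ : Measurable Z)
    (h : P.map Z = gaussianReal 0 v.toNNReal) : ∫ ω, Z ω ^ 2 ∂P = v := by
  have := integral_sq_gaussianReal_zero v.toNNReal
  rw [← h, integral_map (by fun_prop) (by fun_prop), Real.coe_toNNReal _ hv] at this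
  exact this

lemma integrable_pow_four (hZ : MemLp Z 4 P) : Integrable (fun ω => Z ω ^ 4) P := by
  have := hZ.integrable_norm_pow (p := 4) (by simp)
  simpa [Even.pow_abs (by decide : Even 4)] using this

/-- Covariance of the squares of two jointly Gaussian variables, centered at a constant `c`. -/
lemma integral_sq_sub_mul_sq_sub [IsProbabilityMeasure P] {U V : Ω → ℝ} {p q k : ℝ} (c : ℝ)
    (hU : Measurable U) (hV : Measurable V) (hp : 0 ≤ p) (hq : 0 ≤ q) (hk : 2 * |k| ≤ p + q)
    (h : ∀ a b : ℝ, P.map (fun ω => a * U ω + b * V ω) =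
      gaussianReal 0 (a ^ 2 * p + 2 * a * b * k + b ^ 2 * q).toNNReal) :
    ∫ ω, (U ω ^ 2 - c) * (V ω ^ 2 - c) ∂P = 2 * k ^ 2 + (p - c) * (q - c) := by
  have hk' := abs_le.1 (show |k| ≤ (p + q) / 2 by linarith)
  have lU : P.map U = gaussianReal 0 p.toNNReal := by simpa using h 1 0
  have lV : P.map V = gaussianReal 0 q.toNNReal := by simpa using h 0 1
  have lA : P.map (fun ω => U ω + V ω) = gaussianReal 0 (p + 2 * k + q).toNNReal := by
    simpa using h 1 1
  have lS : P.map (fun ω => U ω - V ω) = gaussianReal 0 (p - 2 * k + q).toNNReal := by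
    simpa [sub_eq_add_neg] using h 1 (-1)
  have mU := memLp_four_of_map_eq_gaussianReal hU lU
  have mV := memLp_four_of_map_eq_gaussianReal hV lV
  have iA := integrable_pow_four (memLp_four_of_map_eq_gaussianReal (by fun_prop) lA)
  have iS := integrable_pow_four (memLp_four_of_map_eq_gaussianReal (by fun_prop) lS)
  have iU := integrable_pow_four mU
  have iV := integrable_pow_four mV
  have jU : Integrable (fun ω => U ω ^ 2) P := (mU.mono_exponent (by norm_num)).integrable_sq
  have jV : Integrable (fun ω => V ω ^ 2) P := (mV.mono_exponent (by norm_num)).integrable_sq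
  have eA := integral_pow_four_of_map_eq_gaussianReal (by linarith) (by fun_prop) lA
  have eS := integral_pow_four_of_map_eq_gaussianReal (by linarith) (by fun_prop) lS
  have eU := integral_pow_four_of_map_eq_gaussianReal hp hU lU
  have eV := integral_pow_four_of_map_eq_gaussianReal hq hV lV
  have fU := integral_sq_of_map_eq_gaussianReal hp hU lU
  have fV := integral_sq_of_map_eq_gaussianReal hq hV lV
  have hpol (ω : Ω) : (U ω ^ 2 - c) * (V ω ^ 2 - c) =
      12⁻¹ * ((U ω + V ω) ^ 4 + (U ω - V ω) ^ 4 - 2 * U ω ^ 4 - 2 * V ω ^ 4)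
        - c * (U ω ^ 2 + V ω ^ 2) + c ^ 2 := by ring
  simp_rw [hpol]
  rw [integral_add (by fun_prop) (by fun_prop), integral_sub (by fun_prop) (by fun_prop),
    integral_const_mul, integral_const_mul, integral_sub (by fun_prop) (by fun_prop),
    integral_sub (by fun_prop) (by fun_prop), integral_add (by fun_prop) (by fun_prop),
    integral_add (by fun_prop) (by fun_prop), integral_const_mul, integral_const_mul,
    eA, eS, eU, eV, fU, fV]
  simp
  ring

end GaussianPair

lemma integrable_exp_neg_mul_abs {c : ℝ} (hc : 0 < c) :
    Integrable (fun x : ℝ => Real.exp (-c * |x|)) := by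
  rw [← integrableOn_univ, ← Set.Iic_union_Ioi (a := (0 : ℝ)), integrableOn_union]
  constructor
  · refine (integrableOn_exp_mul_Iic hc 0).congr_fun (fun x hx => ?_) measurableSet_Iic
    simp [abs_of_nonpos (Set.mem_Iic.1 hx)]
  · refine (integrableOn_exp_mul_Ioi (neg_lt_zero.2 hc) 0).congr_fun (fun x hx => ?_)
      measurableSet_Ioi
    simp [abs_of_pos (Set.mem_Ioi.1 hx)]

lemma setIntegral_exp_neg_mul_abs_sub_le {c : ℝ} (hc : 0 < c) (s : Set ℝ) (t : ℝ) :
    ∫ x in s, Real.exp (-c * |t - x|) ≤ 2 / c := by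
  have hI := integrable_exp_neg_mul_abs hc
  refine (setIntegral_le_integral (hI.comp_sub_left t)
    (ae_of_all _ fun x => (Real.exp_pos _).le)).trans ?_
  rw [integral_sub_left_eq_self (fun x : ℝ => Real.exp (-c * |x|)) volume t,
    integral_comp_abs (f := fun x : ℝ => Real.exp (-c * x)),
    integral_exp_mul_Ioi (neg_lt_zero.2 hc)]
  simp [div_eq_mul_inv]

/-- Second moment of a time integral of a process with exponentially decaying correlations. -/
lemma integral_sq_intervalIntegral_le {Ω : Type*} [MeasurableSpace Ω] {P : Measure Ω}
    [IsProbabilityMeasure P] {Y : ℝ → Ω → ℝ} (hY : Measurable (Function.uncurry Y)) {C c : ℝ}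
    (hc : 0 < c) (hL : ∀ s, 0 ≤ s → MemLp (Y s) 2 P)
    (hcov : ∀ s t, 0 ≤ s → 0 ≤ t → ∫ ω, Y s ω * Y t ω ∂P ≤ C * Real.exp (-c * |s - t|))
    {T : ℝ} (hT : 0 ≤ T) :
    Integrable (fun ω => (∫ s in (0 : ℝ)..T, Y s ω) ^ 2) P ∧
      ∫ ω, (∫ s in (0 : ℝ)..T, Y s ω) ^ 2 ∂P ≤ 2 * C / c * T := by
  set μ : Measure ℝ := volume.restrict (Set.Ioc 0 T) with hμ
  have hC (s : ℝ) (hs : 0 ≤ s) : ∫ ω, Y s ω ^ 2 ∂P ≤ C := by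
    simpa [sq] using hcov s s hs hs
  have hC0 : 0 ≤ C := (integral_nonneg fun ω => sq_nonneg (Y 0 ω)).trans (hC 0 le_rfl)
  have hpos : ∀ᵐ z ∂(μ.prod μ), 0 ≤ z.1 ∧ 0 ≤ z.2 := by
    have h0 : ∀ᵐ s ∂μ, 0 ≤ s := by
      filter_upwards [ae_restrict_mem measurableSet_Ioc] with s hs using hs.1.le
    exact (Measure.quasiMeasurePreserving_fst.ae h0).and (Measure.quasiMeasurePreserving_snd.ae h0)
  have hmeas : Measurable fun x : Ω × (ℝ × ℝ) => Y x.2.1 x.1 * Y x.2.2 x.1 :=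
    (hY.comp (by fun_prop : Measurable fun x : Ω × (ℝ × ℝ) => (x.2.1, x.1))).mul
      (hY.comp (by fun_prop : Measurable fun x : Ω × (ℝ × ℝ) => (x.2.2, x.1)))
  have hint : Integrable (fun x : Ω × (ℝ × ℝ) => Y x.2.1 x.1 * Y x.2.2 x.1)
      (P.prod (μ.prod μ)) := by
    rw [integrable_prod_iff' hmeas.aestronglyMeasurable]
    constructor
    · filter_upwards [hpos] with z hz using (hL _ hz.1).integrable_mul (hL _ hz.2)
    · refine (integrable_const C).mono'
        hmeas.norm.aestronglyMeasurable.prod_swap.integral_prod_right' ?_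
      filter_upwards [hpos] with z hz
      have i1 := (hL _ hz.1).integrable_sq
      have i2 := (hL _ hz.2).integrable_sq
      rw [Real.norm_of_nonneg (integral_nonneg fun _ => norm_nonneg _)]
      calc ∫ ω, ‖Y z.1 ω * Y z.2 ω‖ ∂P
          ≤ ∫ ω, (2⁻¹ * Y z.1 ω ^ 2 + 2⁻¹ * Y z.2 ω ^ 2) ∂P := by
            refine integral_mono ((hL _ hz.1).integrable_mul (hL _ hz.2)).norm
              ((i1.const_mul _).add (i2.const_mul _)) fun ω => ?_
            simp only [norm_mul, Real.norm_eq_abs]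
            nlinarith [sq_nonneg (|Y z.1 ω| - |Y z.2 ω|), sq_abs (Y z.1 ω), sq_abs (Y z.2 ω)]
        _ ≤ C := by
            rw [integral_add (i1.const_mul _) (i2.const_mul _), integral_const_mul,
              integral_const_mul]
            linarith [hC _ hz.1, hC _ hz.2]
  have hsq (ω : Ω) : (∫ s in (0 : ℝ)..T, Y s ω) ^ 2 =
      ∫ z, Y z.1 ω * Y z.2 ω ∂(μ.prod μ) := by
    rw [integral_prod_mul (fun s => Y s ω) (fun s => Y s ω), sq,
      intervalIntegral.integral_of_le hT]
  simp_rw [hsq]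
  refine ⟨hint.integral_prod_left, ?_⟩
  rw [integral_integral_swap hint]
  have hexp : Integrable (fun z : ℝ × ℝ => C * Real.exp (-c * |z.1 - z.2|)) (μ.prod μ) := by
    refine (integrable_const C).mono' (by fun_prop) (ae_of_all _ fun z => ?_)
    rw [Real.norm_of_nonneg (by positivity)]
    refine mul_le_of_le_one_right hC0 (Real.exp_le_one_iff.2 ?_)
    nlinarith [abs_nonneg (z.1 - z.2)]
  calc ∫ z, ∫ ω, Y z.1 ω * Y z.2 ω ∂P ∂(μ.prod μ)
      ≤ ∫ z, C * Real.exp (-c * |z.1 - z.2|) ∂(μ.prod μ) := by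
        refine integral_mono_ae hint.integral_prod_right hexp ?_
        filter_upwards [hpos] with z hz using hcov _ _ hz.1 hz.2
    _ = ∫ s, ∫ t, C * Real.exp (-c * |s - t|) ∂μ ∂μ := integral_prod _ hexp
    _ ≤ ∫ s, C * (2 / c) ∂μ := by
        refine integral_mono hexp.integral_prod_left (integrable_const _) fun s => ?_
        simp only [integral_const_mul]
        exact mul_le_mul_of_nonneg_left (setIntegral_exp_neg_mul_abs_sub_le hc _ s) hC0
    _ = 2 * C / c * T := by
        simp [hμ, hT]
        ring

lemma ae_tendsto_zero_of_summable_integral_sq {Ω : Type*} [MeasurableSpace Ω] {P : Measure Ω}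
    {Z : ℕ → Ω → ℝ} (hZ : ∀ n, Integrable (fun ω => Z n ω ^ 2) P)
    (hs : Summable fun n => ∫ ω, Z n ω ^ 2 ∂P) :
    ∀ᵐ ω ∂P, Tendsto (fun n => Z n ω) atTop (nhds 0) := by
  have hlt : ∫⁻ ω, ∑' n, ENNReal.ofReal (Z n ω ^ 2) ∂P ≠ ⊤ := by
    rw [lintegral_tsum fun n => (hZ n).aemeasurable.ennreal_ofReal]
    simp_rw [← ofReal_integral_eq_lintegral_ofReal (hZ _) (ae_of_all _ fun ω => sq_nonneg _)]
    exact hs.tsum_ofReal_ne_top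
  filter_upwards [ae_lt_top' (AEMeasurable.tsum fun n => (hZ n).aemeasurable.ennreal_ofReal) hlt]
    with ω hω
  have h0 := ENNReal.tendsto_atTop_zero_of_tsum_ne_top hω.ne
  have h1 : Tendsto (fun n => Z n ω ^ 2) atTop (nhds 0) := by
    have := (ENNReal.tendsto_toReal ENNReal.zero_ne_top).comp h0
    simpa [Function.comp_def, ENNReal.toReal_ofReal (sq_nonneg _)] using this
  refine (tendsto_zero_iff_abs_tendsto_zero _).2 ?_
  simpa [Function.comp_def, Real.sqrt_sq_eq_abs] using h1.sqrt

lemma tendsto_inv_mul_of_tendsto_sq {A : ℝ → ℝ} {l : ℝ}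
    (hmono : MonotoneOn A (Set.Ici 0)) (h0 : 0 ≤ A 0)
    (h : Tendsto (fun n : ℕ => ((n : ℝ) ^ 2)⁻¹ * A ((n : ℝ) ^ 2)) atTop (nhds l)) :
    Tendsto (fun T => T⁻¹ * A T) atTop (nhds l) := by
  have hn : Tendsto (fun T : ℝ => ⌊√T⌋₊) atTop atTop :=
    tendsto_nat_floor_atTop.comp Real.tendsto_sqrt_atTop
  have hratio : Tendsto (fun n : ℕ => ((n : ℝ) / (n + 1)) ^ 2) atTop (nhds 1) := by
    simpa using (tendsto_natCast_div_add_atTop (1 : ℝ)).pow 2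
  have hratio' : Tendsto (fun n : ℕ => (((n : ℝ) / (n + 1)) ^ 2)⁻¹) atTop (nhds 1) := by
    simpa using hratio.inv₀ one_ne_zero
  have hlow := (hratio.mul h).comp hn
  have hup := (hratio'.mul (h.comp (tendsto_add_atTop_nat 1))).comp hn
  rw [one_mul] at hlow hup
  refine tendsto_of_tendsto_of_tendsto_of_le_of_le' hlow hup ?_ ?_
  all_goals
    filter_upwards [eventually_ge_atTop 1] with T hT
    have hsq := Real.sq_sqrt (show 0 ≤ T by linarith)
    have hf1 : (1 : ℝ) ≤ ⌊√T⌋₊ := by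
      exact_mod_cast (Nat.one_le_floor_iff _).2 (Real.one_le_sqrt.2 hT)
    have hf2 := Nat.floor_le (Real.sqrt_nonneg T)
    have hf3 := (Nat.lt_floor_add_one √T).le
    simp only [Function.comp_apply, Nat.cast_add, Nat.cast_one]
    generalize (⌊√T⌋₊ : ℝ) = n at *
    have hlo : n ^ 2 ≤ T := by nlinarith
    have hhi : T ≤ (n + 1) ^ 2 := by nlinarith [Real.sqrt_nonneg T]
    have hn0 : 0 < n := by linarith
    have hT0 : 0 < T := by linarith
  · have hA : 0 ≤ A (n ^ 2) := h0.trans (hmono (by simp) (by simp; positivity) (by positivity))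
    calc (n / (n + 1)) ^ 2 * ((n ^ 2)⁻¹ * A (n ^ 2)) = ((n + 1) ^ 2)⁻¹ * A (n ^ 2) := by field_simp
      _ ≤ T⁻¹ * A (n ^ 2) := by gcongr
      _ ≤ T⁻¹ * A T := by
        gcongr
        exact hmono (by simp; positivity) hT0.le hlo
  · have hA : 0 ≤ A T := h0.trans (hmono (by simp) hT0.le hT0.le)
    calc T⁻¹ * A T ≤ (n ^ 2)⁻¹ * A T := by gcongr
      _ ≤ (n ^ 2)⁻¹ * A ((n + 1) ^ 2) := by
        gcongr
        exact hmono hT0.le (by simp; positivity) hhi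
      _ = ((n / (n + 1)) ^ 2)⁻¹ * (((n + 1) ^ 2)⁻¹ * A ((n + 1) ^ 2)) := by field_simp

lemma ornsteinUhlenbeck_cov_sq_bound {r s t k : ℝ} (hr : 0 < r) (hs : 0 ≤ s) (ht : 0 ≤ t)
    (hk : k = Real.exp (-r * s) * Real.exp (-r * t) *
      min ((Real.exp (2 * r * s) - 1) / (2 * r)) ((Real.exp (2 * r * t) - 1) / (2 * r))) :
    2 * k ^ 2 + (Real.exp (-r * s) ^ 2 * ((Real.exp (2 * r * s) - 1) / (2 * r)) - 1 / (2 * r)) *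
        (Real.exp (-r * t) ^ 2 * ((Real.exp (2 * r * t) - 1) / (2 * r)) - 1 / (2 * r)) ≤
      3 / (4 * r ^ 2) * Real.exp (-(2 * r) * |s - t|) := by
  wlog hst : s ≤ t generalizing s t
  · have := this ht hs (hk.trans (by rw [min_comm, mul_comm (Real.exp (-r * s))]))
      (le_of_not_ge hst)
    rw [abs_sub_comm] at this
    linarith
  have hmono : (Real.exp (2 * r * s) - 1) / (2 * r) ≤ (Real.exp (2 * r * t) - 1) / (2 * r) := by
    gcongr
  rw [min_eq_left hmono] at hk
  rw [abs_of_nonpos (by linarith)]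
  have hsq (x : ℝ) : Real.exp (2 * r * x) = Real.exp (r * x) ^ 2 := by
    rw [← Real.exp_nat_mul]; ring_nf
  have hneg (x : ℝ) : Real.exp (-r * x) = (Real.exp (r * x))⁻¹ := by
    rw [← Real.exp_neg]; ring_nf
  have hdiff : Real.exp (-(2 * r) * -(s - t)) = (Real.exp (r * s) / Real.exp (r * t)) ^ 2 := by
    rw [← Real.exp_sub, ← Real.exp_nat_mul]; ring_nf
  have ha1 : 1 ≤ Real.exp (r * s) := Real.one_le_exp (by positivity)
  rw [hdiff, hk, hsq, hsq, hneg, hneg]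
  have hb : 0 < Real.exp (r * t) := Real.exp_pos _
  generalize Real.exp (r * s) = a at *
  generalize Real.exp (r * t) = b at *
  have ha : 0 < a := by linarith
  have hid : 3 / (4 * r ^ 2) * (a / b) ^ 2 -
      (2 * (a⁻¹ * b⁻¹ * ((a ^ 2 - 1) / (2 * r))) ^ 2 +
        (a⁻¹ ^ 2 * ((a ^ 2 - 1) / (2 * r)) - 1 / (2 * r)) *
          (b⁻¹ ^ 2 * ((b ^ 2 - 1) / (2 * r)) - 1 / (2 * r))) =
      (a ^ 4 + 4 * a ^ 2 - 3) / (4 * r ^ 2 * a ^ 2 * b ^ 2) := by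
    field_simp
    ring
  have hnum : 0 ≤ a ^ 4 + 4 * a ^ 2 - 3 := by nlinarith [sq_nonneg (a ^ 2)]
  have : 0 ≤ (a ^ 4 + 4 * a ^ 2 - 3) / (4 * r ^ 2 * a ^ 2 * b ^ 2) := by positivity
  linarith

lemma IsStdBM.map_pair {Ω : Type*} [MeasurableSpace Ω] {P : Measure Ω} {W : ℝ → Ω → ℝ}
    (hW : IsStdBM P W) {s t : ℝ} (hs : 0 ≤ s) (ht : 0 ≤ t) (α β : ℝ) :
    P.map (fun ω => α * W s ω + β * W t ω) =
      gaussianReal 0 (α ^ 2 * s + 2 * α * β * min s t + β ^ 2 * t).toNNReal := by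
  have h := hW.2.2.2 2 ![s, t] ![α, β] (by simp [Fin.forall_fin_two, hs, ht])
  simp only [Fin.sum_univ_two, Matrix.cons_val_zero, Matrix.cons_val_one, min_self] at h
  rw [h, min_comm t s]
  congr 2
  ring

theorem stmt_15 {Ω : Type*} [MeasurableSpace Ω] (P : Measure Ω) [IsProbabilityMeasure P]
    (r : ℝ) (hr : 0 < r) (W : ℝ → Ω → ℝ) (hW : IsStdBM P W)
    (X : ℝ → Ω → ℝ)
    (hX : ∀ t ω, X t ω = Real.exp (-r * t) * W ((Real.exp (2 * r * t) - 1) / (2 * r)) ω) :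
    ∀ᵐ ω ∂P, Tendsto (fun T => T⁻¹ * ∫ s in (0:ℝ)..T, (X s ω) ^ 2) atTop
      (nhds (1 / (2 * r))) := by
  set τ : ℝ → ℝ := fun t => (Real.exp (2 * r * t) - 1) / (2 * r) with hτ
  have hτ0 (t : ℝ) (ht : 0 ≤ t) : 0 ≤ τ t :=
    div_nonneg (sub_nonneg.2 (Real.one_le_exp (by positivity))) (by positivity)
  have hXeq (t : ℝ) : X t = fun ω => Real.exp (-r * t) * W (τ t) ω := funext fun ω => hX t ω
  have hXm (t : ℝ) : Measurable (X t) := by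
    rw [hXeq]
    exact (hW.1 _).const_mul _
  have hXc (ω : Ω) : ContinuousOn (fun t => X t ω) (Set.Ici 0) := by
    simp_rw [hXeq]
    refine ContinuousOn.mul (by fun_prop) ((hW.2.1 ω).comp ?_ fun t ht => hτ0 t ht)
    exact Continuous.continuousOn (by fun_prop)
  -- centered squares, frozen at negative times so that the paths are continuous on `ℝ`
  set Y : ℝ → Ω → ℝ := fun t ω => X (max t 0) ω ^ 2 - 1 / (2 * r) with hY
  have hYc (ω : Ω) : Continuous fun t => Y t ω := by
    refine Continuous.sub (Continuous.pow ?_ 2) continuous_const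
    exact (hXc ω).comp_continuous (by fun_prop) fun t => le_max_right t 0
  have hYm : Measurable (Function.uncurry Y) :=
    measurable_uncurry_of_continuous_of_measurable hYc fun t => ((hXm _).pow_const 2).sub_const _
  have hlaw (s t : ℝ) (hs : 0 ≤ s) (ht : 0 ≤ t) (a b : ℝ) :
      P.map (fun ω => a * X s ω + b * X t ω) = gaussianReal 0
        (a ^ 2 * (Real.exp (-r * s) ^ 2 * τ s) +
          2 * a * b * (Real.exp (-r * s) * Real.exp (-r * t) * min (τ s) (τ t)) +
          b ^ 2 * (Real.exp (-r * t) ^ 2 * τ t)).toNNReal := by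
    have h := hW.map_pair (hτ0 s hs) (hτ0 t ht) (a * Real.exp (-r * s)) (b * Real.exp (-r * t))
    simp_rw [hXeq, ← mul_assoc]
    rw [h]
    congr 2
    ring
  have hYL (t : ℝ) (ht : 0 ≤ t) : MemLp (Y t) 2 P := by
    have h4 : MemLp (X t) 4 P :=
      memLp_four_of_map_eq_gaussianReal (hXm t) (by simpa using hlaw t t ht ht 1 0)
    refine MemLp.sub ?_ (memLp_const _)
    rw [max_eq_left ht, memLp_two_iff_integrable_sq ((hXm t).pow_const 2).aestronglyMeasurable]
    simpa only [← pow_mul] using integrable_pow_four h4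
  have hcov (s t : ℝ) (hs : 0 ≤ s) (ht : 0 ≤ t) :
      ∫ ω, Y s ω * Y t ω ∂P ≤ 3 / (4 * r ^ 2) * Real.exp (-(2 * r) * |s - t|) := by
    simp only [hY, max_eq_left hs, max_eq_left ht]
    have h1 := hτ0 s hs
    have h2 := hτ0 t ht
    rw [integral_sq_sub_mul_sq_sub _ (hXm s) (hXm t) (by positivity) (by positivity) ?_
      (hlaw s t hs ht)]
    · exact ornsteinUhlenbeck_cov_sq_bound hr hs ht rfl
    · have hm : 0 ≤ min (τ s) (τ t) := le_min h1 h2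
      rw [abs_of_nonneg (by positivity)]
      have e1 := mul_le_mul_of_nonneg_left (min_le_left (τ s) (τ t))
        (sq_nonneg (Real.exp (-r * s)))
      have e2 := mul_le_mul_of_nonneg_left (min_le_right (τ s) (τ t))
        (sq_nonneg (Real.exp (-r * t)))
      nlinarith [mul_nonneg hm (sq_nonneg (Real.exp (-r * s) - Real.exp (-r * t)))]
  have hmom (n : ℕ) := integral_sq_intervalIntegral_le (P := P) hYm (by positivity : 0 < 2 * r)
    hYL hcov (sq_nonneg (n : ℝ))
  have hXi (ω : Ω) {a b : ℝ} (ha : 0 ≤ a) (hab : a ≤ b) :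
      IntervalIntegrable (fun s => X s ω ^ 2) volume a b := by
    refine ContinuousOn.intervalIntegrable_of_Icc hab (((hXc ω).mono ?_).pow 2)
    exact fun x hx => ha.trans hx.1
  have hae := ae_tendsto_zero_of_summable_integral_sq (P := P)
    (Z := fun n ω => ((n : ℝ) ^ 2)⁻¹ * ∫ s in (0 : ℝ)..(n : ℝ) ^ 2, Y s ω)
    (fun n => by simpa only [mul_pow] using (hmom n).1.const_mul _) (by
      set K := 2 * (3 / (4 * r ^ 2)) / (2 * r)
      refine Summable.of_nonneg_of_le (fun n => integral_nonneg fun ω => sq_nonneg _) (fun n => ?_)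
        ((Real.summable_nat_pow_inv.2 one_lt_two).mul_left K)
      simp only [mul_pow, integral_const_mul]
      refine (mul_le_mul_of_nonneg_left (hmom n).2 (by positivity)).trans_eq ?_
      rcases eq_or_ne (n : ℝ) 0 with hn | hn
      · simp [hn]
      · field_simp)
  filter_upwards [hae] with ω hω
  refine tendsto_inv_mul_of_tendsto_sq (A := fun T => ∫ s in (0 : ℝ)..T, X s ω ^ 2) ?_ (by simp) ?_
  · intro a ha b hb hab
    simp only
    rw [← intervalIntegral.integral_add_adjacent_intervals (hXi ω le_rfl ha) (hXi ω ha hab)]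
    exact le_add_of_nonneg_right (intervalIntegral.integral_nonneg hab fun s _ => sq_nonneg _)
  · have h := hω.add_const (1 / (2 * r))
    rw [zero_add] at h
    refine h.congr' ?_
    filter_upwards [eventually_ge_atTop 1] with n hn
    have hn0 : (n : ℝ) ≠ 0 := by positivity
    have hYX : ∫ s in (0 : ℝ)..(n : ℝ) ^ 2, Y s ω =
        ∫ s in (0 : ℝ)..(n : ℝ) ^ 2, (X s ω ^ 2 - 1 / (2 * r)) := by
      refine intervalIntegral.integral_congr fun s hs => ?_
      rw [Set.uIcc_of_le (sq_nonneg _)] at hs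
      simp only [hY, max_eq_left hs.1]
    rw [hYX, intervalIntegral.integral_sub (hXi ω le_rfl (sq_nonneg _)) (by simp),
      intervalIntegral.integral_const]
    simp only [smul_eq_mul, sub_zero]
    field_simp
    ring
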